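/- Let G₂ be the mapping class group of the closed orientable genus-two surface, presented as below. Then there exists an injective group homomorphism from G₂ into GL(64, ℂ). In particular, the mapping class group of the genus two surface is linear. -/

import Mathlib

/-- The braid relators on `m` generators: `σᵢσⱼσᵢ⁻¹σⱼ⁻¹` for `|i − j| ≥ 2` and
`σᵢσⱼσᵢ(σⱼσᵢσⱼ)⁻¹` for `|i − j| = 1`. -/
def braidRelsSet (m : ℕ) : Set (FreeGroup (Fin m)) :=
  {r | ∃ i j : Fin m,
      (((i : ℕ) + 2 ≤ (j : ℕ) ∨ (j : ℕ) + 2 ≤ (i : ℕ)) ∧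
        r = FreeGroup.of i * FreeGroup.of j * (FreeGroup.of i)⁻¹ * (FreeGroup.of j)⁻¹) ∨
      (((i : ℕ) + 1 = (j : ℕ) ∨ (j : ℕ) + 1 = (i : ℕ)) ∧
        r = FreeGroup.of i * FreeGroup.of j * FreeGroup.of i *
            (FreeGroup.of j * FreeGroup.of i * FreeGroup.of j)⁻¹)}

/-- The word `σ₁σ₂⋯σ_m` in the free group on `m` generators. -/
def braidWord (m : ℕ) : FreeGroup (Fin m) :=
  (List.ofFn fun i : Fin m => FreeGroup.of i).prod

/-- The braid group `B_n`, presented with generators `σ₁, …, σ_{n−1}` and the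
braid relations. -/
abbrev BraidGroup (n : ℕ) := PresentedGroup (braidRelsSet (n - 1))

/-- The generator `σ_{i+1}` of the braid group `B_n` (0-indexed by `i : Fin (n-1)`). -/
def braidGen (n : ℕ) (i : Fin (n - 1)) : BraidGroup n := PresentedGroup.of i

/-- The full twist `Δ² = (σ₁σ₂⋯σ_{n−1})ⁿ` in the braid group `B_n`. -/
def fullTwist (n : ℕ) : BraidGroup n :=
  ((List.ofFn fun i : Fin (n - 1) => braidGen n i).prod) ^ n

/-- The word `σ₁⋯σ_{m-1}σ_m σ_m σ_{m-1}⋯σ₁` (i.e. `σ₁⋯σ_{n−2}σ_{n−1}²σ_{n−2}⋯σ₁`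
for `m = n − 1`) in the free group on `m` generators. -/
def puncturedSphereWord (m : ℕ) : FreeGroup (Fin m) :=
  braidWord m * ((List.ofFn fun i : Fin m => FreeGroup.of i).reverse).prod

/-- The relators for the standard (Magnus) presentation of the mapping class
group of the `n`-times punctured sphere: the braid relators on `n − 1`
generators together with `σ₁⋯σ_{n−2}σ_{n−1}²σ_{n−2}⋯σ₁` and `(σ₁⋯σ_{n−1})ⁿ`. -/
def sphereRelsSet (n : ℕ) : Set (FreeGroup (Fin (n - 1))) :=
  braidRelsSet (n - 1) ∪ {puncturedSphereWord (n - 1), (braidWord (n - 1)) ^ n}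

/-- The mapping class group of the `n`-times punctured sphere, via its standard
presentation. -/
abbrev SphereMCG (n : ℕ) := PresentedGroup (sphereRelsSet n)

/-- The generator `σ_{i+1}` of `SphereMCG n`. -/
def sphereGen (n : ℕ) (i : Fin (n - 1)) : SphereMCG n := PresentedGroup.of i

/-- The relators of the Birman–Hilden presentation of the mapping class group
of the closed genus-two surface: the braid relators on five generators
`ζ₁, …, ζ₅`, together with `(ζ₁ζ₂ζ₃ζ₄ζ₅)⁶ = 1`, `ι² = 1` and `ιζᵢ = ζᵢι`,
where `ι = ζ₁ζ₂ζ₃ζ₄ζ₅ζ₅ζ₄ζ₃ζ₂ζ₁`. -/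
def genus2RelsSet : Set (FreeGroup (Fin 5)) :=
  braidRelsSet 5 ∪ {(braidWord 5) ^ 6, (puncturedSphereWord 5) ^ 2} ∪
    {r | ∃ i : Fin 5,
      r = puncturedSphereWord 5 * FreeGroup.of i * (puncturedSphereWord 5)⁻¹ *
        (FreeGroup.of i)⁻¹}

/-- The mapping class group of the closed orientable genus-two surface, via the
Birman–Hilden presentation. -/
abbrev Genus2MCG := PresentedGroup genus2RelsSet

/-- The generator `ζ_{i+1}` of the genus-two mapping class group. -/
def genus2Gen (i : Fin 5) : Genus2MCG := PresentedGroup.of i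


/-! ### Positive braid words -/

/-- A family of elements of a monoid satisfying the braid relations. -/
structure IsBraid {n : ℕ} {M : Type} [Monoid M] (a : Fin n → M) : Prop where
  comm : ∀ i j : Fin n, (i : ℕ) + 2 ≤ (j : ℕ) → a i * a j = a j * a i
  braid : ∀ i j : Fin n, (i : ℕ) + 1 = (j : ℕ) → a i * a j * a i = a j * a i * a j

/-- Evaluation of a word. -/
def wev {n : ℕ} {M : Type} [Monoid M] (a : Fin n → M) (l : List (Fin n)) : M :=
  (l.map a).prod

@[simp] theorem wev_nil {n : ℕ} {M : Type} [Monoid M] (a : Fin n → M) : wev a [] = 1 := rfl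

@[simp] theorem wev_cons {n : ℕ} {M : Type} [Monoid M] (a : Fin n → M) (s : Fin n)
    (l : List (Fin n)) : wev a (s :: l) = a s * wev a l := by simp [wev]

@[simp] theorem wev_append {n : ℕ} {M : Type} [Monoid M] (a : Fin n → M)
    (l l' : List (Fin n)) : wev a (l ++ l') = wev a l * wev a l' := by simp [wev]

/-- Positive words that agree in every monoid with braid generators. -/
def Weq {n : ℕ} (l l' : List (Fin n)) : Prop :=
  l.length = l'.length ∧
    ∀ (M : Type) [Monoid M] (a : Fin n → M), IsBraid a → wev a l = wev a l'

theorem Weq.refl {n : ℕ} (l : List (Fin n)) : Weq l l := ⟨rfl, fun _ _ _ _ => rfl⟩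

theorem Weq.trans {n : ℕ} {l l' l'' : List (Fin n)} (h : Weq l l') (h' : Weq l' l'') :
    Weq l l'' := ⟨h.1.trans h'.1, fun M _ a ha => (h.2 M a ha).trans (h'.2 M a ha)⟩

theorem Weq.append {n : ℕ} {l l' : List (Fin n)} (p : List (Fin n)) (h : Weq l l') :
    Weq (p ++ l) (p ++ l') := ⟨by simp [h.1], fun M _ a ha => by simp [h.2 M a ha]⟩

theorem Weq.cons {n : ℕ} {l l' : List (Fin n)} (s : Fin n) (h : Weq l l') :
    Weq (s :: l) (s :: l') := h.append [s]

theorem Weq.far {n : ℕ} {s t : Fin n} (h : (s : ℕ) + 2 ≤ (t : ℕ) ∨ (t : ℕ) + 2 ≤ (s : ℕ))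
    (l : List (Fin n)) : Weq (s :: t :: l) (t :: s :: l) := by
  refine ⟨rfl, fun M _ a ha => ?_⟩
  simp only [wev_cons, ← mul_assoc]
  rcases h with h | h
  · rw [ha.comm s t h]
  · rw [ha.comm t s h]

theorem Weq.near {n : ℕ} {s t : Fin n} (h : (s : ℕ) + 1 = (t : ℕ) ∨ (t : ℕ) + 1 = (s : ℕ))
    (l : List (Fin n)) : Weq (s :: t :: s :: l) (t :: s :: t :: l) := by
  refine ⟨rfl, fun M _ a ha => ?_⟩
  simp only [wev_cons, ← mul_assoc]
  rcases h with h | h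
  · rw [ha.braid s t h]
  · rw [ha.braid t s h]

/-- Left division of a positive braid word by a generator. -/
def ldiv {n : ℕ} : ℕ → Fin n → List (Fin n) → Option (List (Fin n))
  | 0, _, _ => none
  | _ + 1, _, [] => none
  | f + 1, t, s :: b =>
    if s = t then some b
    else if (s : ℕ) + 1 = (t : ℕ) ∨ (t : ℕ) + 1 = (s : ℕ) then
      match ldiv f t b with
      | none => none
      | some b2 =>
        match ldiv f s b2 with
        | none => none
        | some b3 => some (s :: t :: b3)
    else
      match ldiv f t b with
      | none => none
      | some b2 => some (s :: b2)

theorem ldiv_sound {n : ℕ} (f : ℕ) : ∀ (t : Fin n) (l r : List (Fin n)),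
    ldiv f t l = some r → Weq l (t :: r) := by
  induction f with
  | zero => intro t l r h; simp [ldiv] at h
  | succ f ih =>
    intro t l r h
    cases l with
    | nil => simp [ldiv] at h
    | cons s b =>
      rw [ldiv] at h
      split_ifs at h with h1 h2
      · cases h; subst h1; exact Weq.refl _
      · cases h3 : ldiv f t b with
        | none => simp [h3] at h
        | some b2 =>
          cases h4 : ldiv f s b2 with
          | none => simp [h3, h4] at h
          | some b3 =>
            simp only [h3, h4, Option.some.injEq] at h
            subst h
            exact (((ih _ _ _ h3).trans ((ih _ _ _ h4).cons t)).cons s).trans (Weq.near h2 _)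
      · cases h3 : ldiv f t b with
        | none => simp [h3] at h
        | some b2 =>
          simp only [h3, Option.some.injEq] at h
          subst h
          refine ((ih _ _ _ h3).cons s).trans (Weq.far ?_ _)
          have : (s : ℕ) ≠ t := fun hh => h1 (Fin.ext hh)
          omega

/-- Checking equality of positive braid words. -/
def wchk {n : ℕ} : List (Fin n) → List (Fin n) → Bool
  | l, [] => l.isEmpty
  | l, t :: r =>
    match ldiv 100 t l with
    | none => false
    | some l2 => wchk l2 r

theorem wchk_sound {n : ℕ} (r : List (Fin n)) : ∀ l : List (Fin n), wchk l r = true → Weq l r := by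
  induction r with
  | nil =>
    intro l h
    rw [wchk, List.isEmpty_iff] at h
    subst h
    exact Weq.refl _
  | cons t r ih =>
    intro l h
    rw [wchk] at h
    cases h3 : ldiv 100 t l with
    | none => simp [h3] at h
    | some l2 =>
      simp only [h3] at h
      exact (ldiv_sound _ _ _ _ h3).trans ((ih _ h).cons t)

/-- A positive word for the Garside element of the braid group on five strands. -/
def gw : List (Fin 4) := [0, 1, 2, 3, 0, 1, 2, 0, 1, 0]

theorem gw_pow : Weq ([0, 1, 2, 3, 0, 1, 2, 3, 0, 1, 2, 3, 0, 1, 2, 3, 0, 1, 2, 3] : List (Fin 4))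
    (gw ++ gw) := wchk_sound _ _ (by decide +kernel)

/-- Words complementary to the generators in the full twist. -/
def cw (s : Fin 4) : List (Fin 4) := (ldiv 100 s (gw ++ gw)).getD []

theorem cw_left : ∀ s : Fin 4, Weq (s :: cw s) (gw ++ gw) := by
  have h : ∀ s : Fin 4, wchk (s :: cw s) (gw ++ gw) = true := by decide +kernel
  exact fun s => wchk_sound _ _ (h s)

theorem cw_right : ∀ s : Fin 4, Weq (cw s ++ [s]) (gw ++ gw) := by
  have h : ∀ s : Fin 4, wchk (cw s ++ [s]) (gw ++ gw) = true := by decide +kernel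
  exact fun s => wchk_sound _ _ (h s)

/-- The words for the point pushes in `B₅`. -/
def pushw : Fin 5 → List (Fin 4)
  | 0 => [0, 1, 2, 3, 3, 2, 1, 0]
  | 1 => [0, 0, 1, 2, 3, 3, 2, 1]
  | 2 => [1, 0, 0, 1, 2, 3, 3, 2]
  | 3 => [2, 1, 0, 0, 1, 2, 3, 3]
  | 4 => [3, 2, 1, 0, 0, 1, 2, 3]

theorem push_all : Weq (pushw 4 ++ pushw 3 ++ pushw 2 ++ pushw 1 ++ pushw 0)
    (gw ++ gw ++ gw ++ gw) := wchk_sound _ _ (by decide +kernel)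

theorem twist_six : Weq ([0, 1, 2, 3, 4, 0, 1, 2, 3, 4, 0, 1, 2, 3, 4, 0, 1, 2, 3, 4,
      0, 1, 2, 3, 4, 0, 1, 2, 3, 4] : List (Fin 5))
    [0, 1, 2, 3, 0, 1, 2, 3, 0, 1, 2, 3, 0, 1, 2, 3, 0, 1, 2, 3,
      4, 3, 2, 1, 0, 0, 1, 2, 3, 4] := wchk_sound _ _ (by decide +kernel)

/-! ### The Lawrence-Krammer representation of `B₅` -/

/-- The Krammer action of the generators of `B₅`. The coordinates are the pairs
`12, 13, 14, 15, 23, 24, 25, 34, 35, 45`. -/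
def krF {R : Type} [CommRing R] (q t : R) (s : Fin 4) (v : Fin 10 → R) : Fin 10 → R :=
  match s with
  | 0 => ![t * q ^ 2 * v 0 + t * q * (q - 1) * v 1 + t * q * (q - 1) * v 2 +
        t * q * (q - 1) * v 3,
      v 4,
      v 5,
      v 6,
      q * v 1 + (1 - q) * v 4,
      q * v 2 + (1 - q) * v 5,
      q * v 3 + (1 - q) * v 6,
      v 7,
      v 8,
      v 9]
  | 1 => ![(1 - q) * v 0 + v 1,
      q * v 0,
      v 2,
      v 3,
      t * q ^ 2 * (q - 1) * v 1 + t * q * (q - 1) ^ 2 * v 2 + t * q * (q - 1) ^ 2 * v 3 +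
        t * q ^ 2 * v 4 + t * q * (q - 1) * v 5 + t * q * (q - 1) * v 6,
      v 7,
      v 8,
      q * v 5 + (1 - q) * v 7,
      q * v 6 + (1 - q) * v 8,
      v 9]
  | 2 => ![v 0,
      (1 - q) * v 1 + v 2,
      q * v 1,
      v 3,
      (1 - q) * v 4 + v 5,
      q * v 4,
      v 6,
      t * q ^ 3 * (q - 1) * v 2 + t * q ^ 2 * (q - 1) ^ 2 * v 3 + t * q ^ 2 * (q - 1) * v 5 +
        t * q * (q - 1) ^ 2 * v 6 + t * q ^ 2 * v 7 + t * q * (q - 1) * v 8,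
      v 9,
      q * v 8 + (1 - q) * v 9]
  | 3 => ![v 0,
      v 1,
      (1 - q) * v 2 + v 3,
      q * v 2,
      v 4,
      (1 - q) * v 5 + v 6,
      q * v 5,
      (1 - q) * v 7 + v 8,
      q * v 7,
      t * q ^ 4 * (q - 1) * v 3 + t * q ^ 3 * (q - 1) * v 6 + t * q ^ 2 * (q - 1) * v 8 +
        t * q ^ 2 * v 9]

/-- The Krammer generators as linear maps. -/
def kr {R : Type} [CommRing R] (q t : R) (s : Fin 4) : Module.End R (Fin 10 → R) where
  toFun := krF q t s
  map_add' v w := by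
    fin_cases s <;> funext i <;> fin_cases i <;> simp [krF] <;> ring
  map_smul' c v := by
    fin_cases s <;> funext i <;> fin_cases i <;> simp [krF] <;> ring

theorem kr_apply {R : Type} [CommRing R] (q t : R) (s : Fin 4) (v : Fin 10 → R) :
    kr q t s v = krF q t s v := rfl

theorem kr_isBraid {R : Type} [CommRing R] (q t : R) : IsBraid (kr q t) := by
  constructor
  · intro i j h
    fin_cases i <;> fin_cases j <;> first | (exfalso; simp at h; done) | skip
    all_goals
      refine LinearMap.ext fun v => funext fun i => ?_
      fin_cases i <;> simp [kr_apply, krF] <;> ring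
  · intro i j h
    fin_cases i <;> fin_cases j <;> first | (exfalso; simp at h; done) | skip
    all_goals
      refine LinearMap.ext fun v => funext fun i => ?_
      fin_cases i <;> simp [kr_apply, krF] <;> ring

/-- The normalized action of the Garside element. -/
def gm {R : Type} [CommRing R] (q : R) (v : Fin 10 → R) : Fin 10 → R :=
  ![q ^ 2 * v 9, q ^ 3 * v 8, q ^ 4 * v 6, q ^ 5 * v 3, q ^ 4 * v 7, q ^ 5 * v 5,
    q ^ 6 * v 2, q ^ 6 * v 4, q ^ 7 * v 1, q ^ 8 * v 0]

theorem gm_gm {R : Type} [CommRing R] (q : R) (v : Fin 10 → R) :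
    gm q (gm q v) = q ^ 10 • v := by
  funext i
  fin_cases i <;> simp [gm] <;> ring

theorem gm_smul {R : Type} [CommRing R] (q c : R) (v : Fin 10 → R) :
    gm q (c • v) = c • gm q v := by
  funext i
  fin_cases i <;> simp [gm] <;> ring

theorem kr_gw {R : Type} [CommRing R] (q t : R) (v : Fin 10 → R) :
    wev (kr q t) gw v = t • gm q v := by
  funext i
  simp only [gw, wev_cons, wev_nil, mul_one, Module.End.mul_apply, kr_apply]
  fin_cases i <;> simp [krF, gm] <;> ring

theorem kr_map {R S : Type} [CommRing R] [CommRing S] (φ : R →+* S) (q t : R)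
    (l : List (Fin 4)) (v : Fin 10 → R) :
    (fun i => φ (wev (kr q t) l v i)) = wev (kr (φ q) (φ t)) l (fun i => φ (v i)) := by
  induction l with
  | nil => rfl
  | cons s l ih =>
    simp only [wev_cons, Module.End.mul_apply, ← ih]
    generalize wev (kr q t) l v = w
    simp only [kr_apply]
    fin_cases s <;> funext i <;> fin_cases i <;> simp [krF]

/-! ### The positivity argument -/

/-- The Krammer generators at `t = 0`, `q = 1/2`. -/
abbrev k0 : Fin 4 → Module.End ℚ (Fin 10 → ℚ) := kr (1 / 2 : ℚ) 0

/-- The coordinates of the simple roots. -/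
def alph : Fin 4 → Fin 10 := ![0, 4, 7, 9]

theorem k0_nonneg (s : Fin 4) (v : Fin 10 → ℚ) (hv : ∀ i, 0 ≤ v i) (i : Fin 10) :
    0 ≤ k0 s v i := by
  have h0 := hv 0
  have h1 := hv 1
  have h2 := hv 2
  have h3 := hv 3
  have h4 := hv 4
  have h5 := hv 5
  have h6 := hv 6
  have h7 := hv 7
  have h8 := hv 8
  have h9 := hv 9
  rw [kr_apply]
  fin_cases s <;> fin_cases i <;> simp [krF] <;> linarith

theorem k0w_nonneg (l : List (Fin 4)) (v : Fin 10 → ℚ) (hv : ∀ i, 0 ≤ v i) :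
    ∀ i, 0 ≤ wev k0 l v i := by
  induction l with
  | nil => simpa using hv
  | cons s l ih =>
    simp only [wev_cons, Module.End.mul_apply]
    exact k0_nonneg s _ ih

theorem k0_self (s : Fin 4) (v : Fin 10 → ℚ) : k0 s v (alph s) = 0 := by
  rw [kr_apply]
  fin_cases s <;> simp [krF, alph]

theorem k0_ne (s t : Fin 4) (h : s ≠ t) (v : Fin 10 → ℚ) (hv : ∀ i, 0 ≤ v i)
    (h0 : k0 s v (alph t) = 0) : v (alph t) = 0 := by
  have h0' := hv 0
  have h1 := hv 1
  have h2 := hv 2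
  have h3 := hv 3
  have h4 := hv 4
  have h5 := hv 5
  have h6 := hv 6
  have h7 := hv 7
  have h8 := hv 8
  have h9 := hv 9
  rw [kr_apply] at h0
  fin_cases s <;> fin_cases t <;> first | (exact absurd rfl h) | skip
  all_goals
    simp [krF, alph] at h0 ⊢
    linarith

theorem k0_near (s t : Fin 4) (h : (s : ℕ) + 1 = (t : ℕ) ∨ (t : ℕ) + 1 = (s : ℕ))
    (v : Fin 10 → ℚ) (hv : ∀ i, 0 ≤ v i)
    (h0 : k0 s (k0 t v) (alph t) = 0) : v (alph s) = 0 := by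
  have h0' := hv 0
  have h1 := hv 1
  have h2 := hv 2
  have h3 := hv 3
  have h4 := hv 4
  have h5 := hv 5
  have h6 := hv 6
  have h7 := hv 7
  have h8 := hv 8
  have h9 := hv 9
  rw [kr_apply, kr_apply] at h0
  fin_cases s <;> fin_cases t <;> first | (exfalso; simp at h; done) | skip
  all_goals
    simp [krF, alph] at h0 ⊢
    linarith

/-- The row of a simple root vanishes at `t = 0`. -/
def Zr (l : List (Fin 4)) (s : Fin 4) : Prop :=
  ∀ v : Fin 10 → ℚ, (∀ i, 0 ≤ v i) → wev k0 l v (alph s) = 0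

theorem Weq.k0 {l l' : List (Fin 4)} (h : Weq l l') : wev k0 l = wev k0 l' :=
  h.2 _ _ (kr_isBraid _ _)

/-- If the row of the simple root `s` vanishes, then `s` divides the word on the left. -/
theorem Zr.dvd (N : ℕ) : ∀ (l : List (Fin 4)) (t : Fin 4), l.length ≤ N → Zr l t →
    ∃ r, Weq l (t :: r) := by
  induction N with
  | zero =>
    intro l t hl hz
    have : l = [] := by simpa using hl
    subst this
    have := hz (fun _ => 1) (fun _ => zero_le_one)
    simp at this
  | succ N ih =>
    intro l t hl hz
    cases l with
    | nil =>
      have := hz (fun _ => 1) (fun _ => zero_le_one)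
      simp at this
    | cons s b =>
      simp only [List.length_cons, Nat.add_le_add_iff_right] at hl
      by_cases hst : s = t
      · subst hst; exact ⟨b, Weq.refl _⟩
      have hzb : Zr b t := fun v hv => by
        have := hz v hv
        simp only [wev_cons, Module.End.mul_apply] at this
        exact k0_ne s t hst _ (k0w_nonneg b v hv) this
      obtain ⟨b2, hb2⟩ := ih b t hl hzb
      by_cases hn : (s : ℕ) + 1 = (t : ℕ) ∨ (t : ℕ) + 1 = (s : ℕ)
      · have hzb2 : Zr b2 s := fun v hv => by
          have := hz v hv
          rw [(hb2.cons s).k0] at this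
          simp only [wev_cons, Module.End.mul_apply] at this
          exact k0_near s t hn _ (k0w_nonneg b2 v hv) this
        have hl2 : b2.length ≤ N := by
          have := hb2.1
          simp only [List.length_cons] at this
          omega
        obtain ⟨b3, hb3⟩ := ih b2 s hl2 hzb2
        exact ⟨s :: t :: b3, ((hb2.trans (hb3.cons t)).cons s).trans (Weq.near hn _)⟩
      · refine ⟨s :: b2, (hb2.cons s).trans (Weq.far ?_ _)⟩
        have : (s : ℕ) ≠ t := fun hh => hst (Fin.ext hh)
        omega

/-- A vanishing step in the extraction of the Garside element. -/
theorem strip (l p r : List (Fin 4)) (s : Fin 4) (h : Weq l (p ++ r))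
    (h0 : ∀ v : Fin 10 → ℚ, (∀ i, 0 ≤ v i) → wev k0 l v = 0)
    (hp : ∀ w : Fin 10 → ℚ, (∀ i, 0 ≤ w i) → wev k0 p w = 0 → w (alph s) = 0) :
    ∃ r', Weq l ((p ++ [s]) ++ r') := by
  have hz : Zr r s := fun v hv => by
    refine hp _ (k0w_nonneg r v hv) ?_
    have := h0 v hv
    rwa [h.k0, wev_append, Module.End.mul_apply] at this
  obtain ⟨r', hr'⟩ := Zr.dvd _ r s le_rfl hz
  refine ⟨r', h.trans ?_⟩
  simpa using hr'.append p

theorem zero_dvd_gw (l : List (Fin 4))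
    (h0 : ∀ v : Fin 10 → ℚ, (∀ i, 0 ≤ v i) → wev k0 l v = 0) : ∃ r, Weq l (gw ++ r) := by
  have key : ∀ (p : List (Fin 4)) (s : Fin 4),
      (∃ i : Fin 10, ∃ c : ℚ, 0 < c ∧ ∀ w : Fin 10 → ℚ, (∀ i, 0 ≤ w i) →
        c * w (alph s) ≤ wev k0 p w i) →
      (∃ r, Weq l (p ++ r)) → ∃ r, Weq l ((p ++ [s]) ++ r) := by
    rintro p s ⟨i, c, hc, hi⟩ ⟨r, hr⟩
    refine strip l p r s hr h0 fun w hw hz => ?_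
    have h1 := hi w hw
    rw [hz] at h1
    have h2 := hw (alph s)
    simp only [Pi.zero_apply] at h1
    have h3 := nonpos_of_mul_nonpos_right h1 hc
    exact le_antisymm h3 h2
  have e0 : ∃ r, Weq l ([] ++ r) := ⟨l, Weq.refl l⟩
  have e1 := key [] 0 ⟨0, 1 / 1, by norm_num, fun w hw => by
    have := hw 0
    simp [kr_apply, krF, alph]; try linarith [hw 0, hw 1, hw 2, hw 3, hw 4, hw 5, hw 6, hw 7, hw 8, hw 9]⟩ e0
  have e2 := key [0] 1 ⟨1, 1 / 1, by norm_num, fun w hw => by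
    have := hw 0
    simp [kr_apply, krF, alph]; try linarith [hw 0, hw 1, hw 2, hw 3, hw 4, hw 5, hw 6, hw 7, hw 8, hw 9]⟩ e1
  have e3 := key [0, 1] 2 ⟨2, 1 / 1, by norm_num, fun w hw => by
    have := hw 0
    simp [kr_apply, krF, alph]; try linarith [hw 0, hw 1, hw 2, hw 3, hw 4, hw 5, hw 6, hw 7, hw 8, hw 9]⟩ e2
  have e4 := key [0, 1, 2] 3 ⟨3, 1 / 1, by norm_num, fun w hw => by
    have := hw 0
    simp [kr_apply, krF, alph]; try linarith [hw 0, hw 1, hw 2, hw 3, hw 4, hw 5, hw 6, hw 7, hw 8, hw 9]⟩ e3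
  have e5 := key [0, 1, 2, 3] 0 ⟨4, 1 / 4, by norm_num, fun w hw => by
    have := hw 0
    simp [kr_apply, krF, alph]; try linarith [hw 0, hw 1, hw 2, hw 3, hw 4, hw 5, hw 6, hw 7, hw 8, hw 9]⟩ e4
  have e6 := key [0, 1, 2, 3, 0] 1 ⟨5, 1 / 4, by norm_num, fun w hw => by
    have := hw 0
    simp [kr_apply, krF, alph]; try linarith [hw 0, hw 1, hw 2, hw 3, hw 4, hw 5, hw 6, hw 7, hw 8, hw 9]⟩ e5
  have e7 := key [0, 1, 2, 3, 0, 1] 2 ⟨6, 1 / 4, by norm_num, fun w hw => by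
    have := hw 0
    simp [kr_apply, krF, alph]; try linarith [hw 0, hw 1, hw 2, hw 3, hw 4, hw 5, hw 6, hw 7, hw 8, hw 9]⟩ e6
  have e8 := key [0, 1, 2, 3, 0, 1, 2] 0 ⟨7, 1 / 16, by norm_num, fun w hw => by
    have := hw 0
    simp [kr_apply, krF, alph]; try linarith [hw 0, hw 1, hw 2, hw 3, hw 4, hw 5, hw 6, hw 7, hw 8, hw 9]⟩ e7
  have e9 := key [0, 1, 2, 3, 0, 1, 2, 0] 1 ⟨8, 1 / 16, by norm_num, fun w hw => by
    have := hw 0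
    simp [kr_apply, krF, alph]; try linarith [hw 0, hw 1, hw 2, hw 3, hw 4, hw 5, hw 6, hw 7, hw 8, hw 9]⟩ e8
  have e10 := key [0, 1, 2, 3, 0, 1, 2, 0, 1] 0 ⟨9, 1 / 64, by norm_num, fun w hw => by
    have := hw 0
    simp [kr_apply, krF, alph]; try linarith [hw 0, hw 1, hw 2, hw 3, hw 4, hw 5, hw 6, hw 7, hw 8, hw 9]⟩ e9
  exact e10

/-! ### Scalar positive braids are powers of the full twist -/

theorem kr_map' {R S : Type} [CommRing R] [CommRing S] (φ : R →+* S) (q t : R) (q' t' : S)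
    (hq : φ q = q') (ht : φ t = t') (l : List (Fin 4)) (v : Fin 10 → R) (v' : Fin 10 → S)
    (hv : ∀ i, φ (v i) = v' i) (i : Fin 10) :
    φ (wev (kr q t) l v i) = wev (kr q' t') l v' i := by
  subst hq ht
  have : v' = fun i => φ (v i) := funext fun i => (hv i).symm
  subst this
  exact congrFun (kr_map φ q t l v) i

theorem k0w_self (s : Fin 4) (l : List (Fin 4)) (v : Fin 10 → ℚ) :
    wev k0 (s :: l) v (alph s) = 0 := by
  rw [wev_cons, Module.End.mul_apply, k0_self]

/-- The Krammer generators over `ℚ[X]`, with `q = 1/2` and `t = X`. -/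
noncomputable abbrev kX : Fin 4 → Module.End (Polynomial ℚ) (Fin 10 → Polynomial ℚ) :=
  kr (Polynomial.C (1 / 2 : ℚ)) Polynomial.X

theorem kX_eval (l : List (Fin 4)) (v : Fin 10 → ℚ) (i : Fin 10) :
    (wev kX l (fun i => Polynomial.C (v i)) i).eval 0 = wev k0 l v i := by
  exact kr_map' (Polynomial.evalRingHom (0 : ℚ)) _ _ _ _ (Polynomial.eval_C)
    (Polynomial.eval_X) l _ _ (fun _ => Polynomial.eval_C) i

/-- The full twist word repeated. -/
def tw (m : ℕ) : List (Fin 4) := (List.replicate m (gw ++ gw)).flatten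

theorem gm_ones (i : Fin 10) : gm (1 / 2 : ℚ) (fun _ => 1) i ≠ 0 := by
  fin_cases i <;> simp [gm]

theorem gm_eval (v : Fin 10 → ℚ) (i : Fin 10) :
    (gm (Polynomial.C (1 / 2 : ℚ)) (fun i => Polynomial.C (v i)) i).eval 0
      = gm (1 / 2 : ℚ) v i := by
  fin_cases i <;> simp [gm]

theorem scalar_twist (N : ℕ) : ∀ (l : List (Fin 4)) (P : Polynomial ℚ), l.length ≤ N →
    (∀ v, wev kX l v = P • v) → ∃ m, Weq l (tw m) := by
  induction N using Nat.strong_induction_on with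
  | _ N ih =>
  intro l P hl hP
  cases hl0 : l with
  | nil => exact ⟨0, Weq.refl _⟩
  | cons s l' =>
    rw [← hl0]
    have hq : (Polynomial.C (1 / 2 : ℚ)) ≠ 0 := by simp
    -- the scalar vanishes at zero
    have hP0 : P.eval 0 = 0 := by
      have h1 := kX_eval l (fun _ => 1) (alph s)
      rw [hP, hl0, k0w_self] at h1
      simpa using h1
    obtain ⟨P1, rfl⟩ := Polynomial.X_dvd_iff.2
      (by rw [Polynomial.coeff_zero_eq_eval_zero]; exact hP0 : P.coeff 0 = 0)
    obtain ⟨l1, hl1⟩ := zero_dvd_gw l (fun v _ => by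
      funext i
      rw [← kX_eval, hP]
      simp)
    have h1 : ∀ v, gm (Polynomial.C (1 / 2 : ℚ)) (wev kX l1 v) = P1 • v := by
      intro v
      have h2 := hP v
      rw [hl1.2 _ _ (kr_isBraid _ _), wev_append, Module.End.mul_apply, kr_gw, mul_smul] at h2
      exact smul_right_injective _ Polynomial.X_ne_zero h2
    have h2 : ∀ v, (Polynomial.C (1 / 2 : ℚ)) ^ 10 • wev kX l1 v
        = P1 • gm (Polynomial.C (1 / 2 : ℚ)) v := by
      intro v
      rw [← gm_gm, h1, gm_smul]
    cases hl10 : l1 with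
    | nil =>
      exfalso
      subst hl10
      have h3 := congrFun (h2 (Pi.single 0 1)) 0
      have h4 := congrFun (h2 (Pi.single 0 1)) 9
      simp [gm] at h3
    | cons s1 l1' =>
      have hP1 : P1.eval 0 = 0 := by
        have h3 := kX_eval l1 (fun _ => 1) (alph s1)
        have h3' : wev k0 l1 (fun _ => 1) (alph s1) = 0 := by rw [hl10, k0w_self]
        rw [h3'] at h3
        have h4 := congrArg (Polynomial.eval 0)
          (congrFun (h2 (fun _ => Polynomial.C 1)) (alph s1))
        simp only [Pi.smul_apply, smul_eq_mul, Polynomial.eval_mul, h3, mul_zero] at h4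
        have h5 := gm_eval (fun _ => 1) (alph s1)
        rw [h5] at h4
        exact (mul_eq_zero.1 h4.symm).resolve_right (gm_ones _)
      obtain ⟨P2, rfl⟩ := Polynomial.X_dvd_iff.2
        (by rw [Polynomial.coeff_zero_eq_eval_zero]; exact hP1 : P1.coeff 0 = 0)
      obtain ⟨l2, hl2⟩ := zero_dvd_gw l1 (fun v _ => by
        funext i
        have h3 := congrArg (Polynomial.eval 0)
          (congrFun (h2 (fun i => Polynomial.C (v i))) i)
        simp only [Pi.smul_apply, smul_eq_mul, Polynomial.eval_mul, kX_eval] at h3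
        simpa using h3)
      have h3 : ∀ v, (Polynomial.C (1 / 2 : ℚ)) ^ 10 • wev kX l2 v = P2 • v := by
        intro v
        have h4 := h1 v
        rw [hl2.2 _ _ (kr_isBraid _ _), wev_append, Module.End.mul_apply, kr_gw, gm_smul, gm_gm,
          mul_smul] at h4
        exact smul_right_injective _ Polynomial.X_ne_zero h4
      have hlen : l2.length + 20 ≤ l.length := by
        have e1 := hl1.1
        have e2 := hl2.1
        simp [gw] at e1 e2
        omega
      obtain ⟨m, hm⟩ := ih l2.length (by omega) l2 (Polynomial.C (2 ^ 10) * P2) le_rfl (by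
        intro v
        rw [mul_smul, ← h3 v, smul_smul, ← Polynomial.C_pow, ← Polynomial.C_mul]
        norm_num)
      refine ⟨m + 1, ?_⟩
      have h5 := hl1.trans ((hl2.trans (hm.append gw)).append gw)
      have h6 : tw (m + 1) = gw ++ (gw ++ tw m) := by
        simp [tw, List.replicate_succ]
      rw [h6]
      exact h5

/-- A transcendental complex number exists. -/
theorem exists_transc : ∃ z : ℂ, Transcendental ℚ z := by
  by_contra h
  push Not at h
  have h1 : Cardinal.mk ℂ ≤ Cardinal.aleph0 := by
    have hA : Algebra.IsAlgebraic ℚ ℂ := ⟨fun z => by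
      have := h z
      simpa [Transcendental] using this⟩
    have := Algebra.IsAlgebraic.cardinalMk_le_max ℚ ℂ
    simpa using this
  rw [Cardinal.mk_complex] at h1
  exact absurd h1 (not_le.2 Cardinal.aleph0_lt_continuum)

/-- Scalar positive braids in the complex Krammer representation. -/
theorem scalar_twist_complex (z : ℂ) (hz : Transcendental ℚ z) (l : List (Fin 4)) (c : ℂ)
    (h : ∀ v, wev (kr (1 / 2 : ℂ) z) l v = c • v) : ∃ m, Weq l (tw m) := by
  have hinj : Function.Injective (Polynomial.aeval z : Polynomial ℚ →ₐ[ℚ] ℂ) :=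
    transcendental_iff_injective.1 hz
  have hm : ∀ (v : Fin 10 → Polynomial ℚ) (i : Fin 10),
      Polynomial.aeval z (wev kX l v i) = c * Polynomial.aeval z (v i) := by
    intro v i
    have h1 := kr_map' (Polynomial.aeval z : Polynomial ℚ →ₐ[ℚ] ℂ).toRingHom
      (Polynomial.C (1 / 2 : ℚ)) Polynomial.X (1 / 2) z (by simp) (by simp) l v _
      (fun _ => rfl) i
    rw [h] at h1
    exact h1
  refine scalar_twist l.length l (wev kX l (fun _ => 1) 0) le_rfl fun v => funext fun i => hinj ?_
  rw [hm, Pi.smul_apply, smul_eq_mul, map_mul, hm]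
  simp

/-! ### The normalized complex representation -/

theorem wev_smul {n : ℕ} {U : Type} [AddCommGroup U] [Module ℂ U] (a : Fin n → Module.End ℂ U)
    (c : ℂ) (l : List (Fin n)) : wev (fun s => c • a s) l = c ^ l.length • wev a l := by
  induction l with
  | nil => simp
  | cons s l ih =>
    simp only [wev_cons, ih, List.length_cons, pow_succ']
    rw [smul_mul_assoc, mul_smul_comm, smul_smul]

theorem wev_map {n : ℕ} {M N : Type} [Monoid M] [Monoid N] (f : M →* N) (a : Fin n → M)
    (l : List (Fin n)) : f (wev a l) = wev (fun s => f (a s)) l := by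
  induction l with
  | nil => simp
  | cons s l ih => simp [ih]

/-- The representation space of the Krammer representation of `B₅`. -/
abbrev KU := Fin 10 → ℂ

theorem exists_rep : ∃ a : Fin 4 → (Module.End ℂ KU)ˣ, IsBraid a ∧ wev a (gw ++ gw) = 1 ∧
    ∀ l, wev a l = 1 → ∃ m, Weq l (tw m) := by
  obtain ⟨z, hz⟩ := exists_transc
  have hz0 : z ≠ 0 := by
    rintro rfl
    exact hz (isAlgebraic_zero)
  obtain ⟨c, hc⟩ := IsAlgClosed.exists_pow_nat_eq ((z * z * (1 / 2) ^ 10)⁻¹ : ℂ)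
    (n := 20) (by norm_num)
  have hzz : (z * z * (1 / 2) ^ 10 : ℂ) ≠ 0 := by simp [hz0]
  have hc0 : c ≠ 0 := by
    rintro rfl
    rw [zero_pow (by norm_num)] at hc
    exact inv_ne_zero hzz hc.symm
  let b : Fin 4 → Module.End ℂ KU := fun s => c • kr (1 / 2 : ℂ) z s
  have hb : IsBraid b := by
    have h := kr_isBraid (1 / 2 : ℂ) z
    constructor
    · intro i j hij
      simp only [b, smul_mul_assoc, mul_smul_comm]
      rw [h.comm i j hij]
    · intro i j hij
      simp only [b, smul_mul_assoc, mul_smul_comm]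
      rw [h.braid i j hij]
  have htw : wev b (gw ++ gw) = 1 := by
    refine LinearMap.ext fun v => ?_
    simp only [b, wev_smul, wev_append, LinearMap.smul_apply, Module.End.mul_apply, kr_gw,
      gm_smul, gm_gm, smul_smul, Module.End.one_apply]
    have : c ^ gw.length * c ^ gw.length * (z * (z * (1 / 2) ^ 10)) = 1 := by
      rw [← pow_add]
      have : gw.length + gw.length = 20 := rfl
      rw [this, hc, ← mul_assoc z z]
      exact inv_mul_cancel₀ hzz
    have h2 : c ^ gw.length * (z * (c ^ gw.length * z * (1 / 2) ^ 10)) = 1 := by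
      linear_combination this
    rw [h2, one_smul]
  let a : Fin 4 → (Module.End ℂ KU)ˣ := fun s =>
    ⟨b s, wev b (cw s),
      by rw [← wev_cons, (cw_left s).2 _ b hb, htw],
      by
        have := (cw_right s).2 _ b hb
        rw [wev_append, htw] at this
        simpa using this⟩
  have hab : ∀ l, ((wev a l : (Module.End ℂ KU)ˣ) : Module.End ℂ KU) = wev b l := fun l =>
    wev_map (Units.coeHom (Module.End ℂ KU)) a l
  refine ⟨a, ⟨?_, ?_⟩, ?_, ?_⟩
  · intro i j hij
    exact Units.ext (hb.comm i j hij)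
  · intro i j hij
    exact Units.ext (hb.braid i j hij)
  · exact Units.ext ((hab _).trans htw)
  · intro l hl
    refine scalar_twist_complex z hz l ((c ^ l.length)⁻¹) fun v => ?_
    have h1 : wev b l = 1 := by rw [← hab, hl]; rfl
    have h2 := congrArg (fun f : Module.End ℂ KU => (c ^ l.length)⁻¹ • f v) h1
    simp only [b, wev_smul, LinearMap.smul_apply, smul_smul, Module.End.one_apply] at h2
    rwa [inv_mul_cancel₀ (pow_ne_zero _ hc0), one_smul] at h2

/-! ### Monomial matrices over a group -/

/-- Monomial `6 × 6` matrices over a group. -/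
@[ext] structure Mono (Q : Type) where
  /-- the permutation -/
  p : Equiv.Perm (Fin 6)
  /-- the nonzero entries -/
  c : Fin 6 → Q

instance monoGroup (Q : Type) [Group Q] : Group (Mono Q) where
  mul x y := ⟨y.p * x.p, fun k => x.c k * y.c (x.p k)⟩
  one := ⟨1, fun _ => 1⟩
  inv x := ⟨x.p⁻¹, fun k => (x.c (x.p⁻¹ k))⁻¹⟩
  mul_assoc x y z := by
    apply Mono.ext
    · exact (mul_assoc _ _ _).symm
    · funext k
      exact mul_assoc _ _ _
  one_mul x := by
    apply Mono.ext
    · exact mul_one _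
    · funext k
      exact one_mul _
  mul_one x := by
    apply Mono.ext
    · exact one_mul _
    · funext k
      exact mul_one _
  inv_mul_cancel x := by
    apply Mono.ext
    · exact mul_inv_cancel _
    · funext k
      exact inv_mul_cancel _

@[simp] theorem mono_mul_p {Q : Type} [Group Q] (x y : Mono Q) : (x * y).p = y.p * x.p := rfl
@[simp] theorem mono_mul_c {Q : Type} [Group Q] (x y : Mono Q) (k : Fin 6) :
    (x * y).c k = x.c k * y.c (x.p k) := rfl
@[simp] theorem mono_one_p {Q : Type} [Group Q] : (1 : Mono Q).p = 1 := rfl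
@[simp] theorem mono_one_c {Q : Type} [Group Q] (k : Fin 6) : (1 : Mono Q).c k = 1 := rfl

/-- The entries of the images of the generators. -/
def mgc {Q : Type} [Group Q] (a : Fin 4 → Q) : Fin 5 → Fin 6 → Q
  | 0 => ![(wev a (pushw 0))⁻¹, 1, a 0, a 0, a 0, a 0]
  | 1 => ![a 0, (wev a (pushw 1))⁻¹, 1, a 1, a 1, a 1]
  | 2 => ![a 1, a 1, (wev a (pushw 2))⁻¹, 1, a 2, a 2]
  | 3 => ![a 2, a 2, a 2, (wev a (pushw 3))⁻¹, 1, a 3]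
  | 4 => ![a 3, a 3, a 3, a 3, (wev a (pushw 4))⁻¹, 1]

/-- The permutations of the images of the generators. -/
def mgp (i : Fin 5) : Equiv.Perm (Fin 6) := Equiv.swap i.castSucc i.succ

/-- Table of values of the permutations. -/
def mgt : Fin 5 → Fin 6 → Fin 6
  | 0 => ![1, 0, 2, 3, 4, 5]
  | 1 => ![0, 2, 1, 3, 4, 5]
  | 2 => ![0, 1, 3, 2, 4, 5]
  | 3 => ![0, 1, 2, 4, 3, 5]
  | 4 => ![0, 1, 2, 3, 5, 4]

theorem mgp_apply : ∀ (i : Fin 5) (k : Fin 6), mgp i k = mgt i k := by decide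

/-- The images of the generators. -/
def mg {Q : Type} [Group Q] (a : Fin 4 → Q) (i : Fin 5) : Mono Q := ⟨mgp i, mgc a i⟩

theorem push_comm {Q : Type} [Group Q] {a : Fin 4 → Q} (ha : IsBraid a) (i : Fin 5) (j : Fin 4)
    (h : i ≠ j.castSucc) (h' : i ≠ j.succ) :
    a j * wev a (pushw i) = wev a (pushw i) * a j := by
  have h1 : ∀ (i : Fin 5) (j : Fin 4), i ≠ j.castSucc → i ≠ j.succ →
      wchk (j :: pushw i) (pushw i ++ [j]) = true := by decide +kernel
  have := (wchk_sound _ _ (h1 i j h h')).2 Q a ha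
  simpa using this

theorem push_conj {Q : Type} [Group Q] {a : Fin 4 → Q} (ha : IsBraid a) (j : Fin 4) :
    a j * wev a (pushw j.castSucc) = wev a (pushw j.succ) * a j := by
  have h1 : ∀ (j : Fin 4),
      wchk (j :: pushw j.castSucc) (pushw j.succ ++ [j]) = true := by decide +kernel
  have := (wchk_sound _ _ (h1 j)).2 Q a ha
  simpa using this

theorem push_pair {Q : Type} [Group Q] {a : Fin 4 → Q} (ha : IsBraid a) (j : Fin 4) :
    a j * (wev a (pushw j.succ) * wev a (pushw j.castSucc)) =
      wev a (pushw j.succ) * wev a (pushw j.castSucc) * a j := by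
  have h1 : ∀ (j : Fin 4),
      wchk (j :: (pushw j.succ ++ pushw j.castSucc)) ((pushw j.succ ++ pushw j.castSucc) ++ [j])
        = true := by decide +kernel
  have := (wchk_sound _ _ (h1 j)).2 Q a ha
  simpa [mul_assoc] using this

theorem push_comm_inv {Q : Type} [Group Q] {a : Fin 4 → Q} (ha : IsBraid a) (i : Fin 5)
    (j : Fin 4) (h : i ≠ j.castSucc) (h' : i ≠ j.succ) :
    (wev a (pushw i))⁻¹ * a j = a j * (wev a (pushw i))⁻¹ :=
  (Commute.inv_right (show Commute (a j) _ from push_comm ha i j h h')).eq.symm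

theorem push_conj_inv {Q : Type} [Group Q] {a : Fin 4 → Q} (ha : IsBraid a) (j : Fin 4) :
    a j * (wev a (pushw j.castSucc))⁻¹ = (wev a (pushw j.succ))⁻¹ * a j := by
  have := push_conj ha j
  rw [eq_inv_mul_iff_mul_eq, ← mul_assoc, ← this, mul_assoc, mul_inv_cancel, mul_one]

theorem push_pair_inv {Q : Type} [Group Q] {a : Fin 4 → Q} (ha : IsBraid a) (j : Fin 4) :
    (wev a (pushw j.castSucc))⁻¹ * (wev a (pushw j.succ))⁻¹ * a j =
      a j * (wev a (pushw j.castSucc))⁻¹ * (wev a (pushw j.succ))⁻¹ := by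
  have h := (Commute.inv_right (show Commute (a j) _ from push_pair ha j)).eq
  rw [mul_inv_rev] at h
  rw [← h, mul_assoc]

theorem mg_isBraid {Q : Type} [Group Q] {a : Fin 4 → Q} (ha : IsBraid a) : IsBraid (mg a) := by
  have p1 : ∀ i j : Fin 5, (i : ℕ) + 2 ≤ (j : ℕ) → mgp j * mgp i = mgp i * mgp j := by decide
  have p2 : ∀ i j : Fin 5, (i : ℕ) + 1 = (j : ℕ) →
      mgp i * (mgp j * mgp i) = mgp j * (mgp i * mgp j) := by decide
  constructor
  · intro i j h
    apply Mono.ext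
    · exact p1 i j h
    · funext k
      fin_cases i <;> fin_cases j <;> first | (exfalso; simp at h; done) | skip
      all_goals
        clear h
        fin_cases k <;> simp [mg, mgp_apply, mgt, mgc]
        all_goals first
          | exact ha.comm _ _ (by decide)
          | exact (ha.comm _ _ (by decide)).symm
          | exact push_comm_inv ha _ _ (by decide) (by decide)
          | exact (push_comm_inv ha _ _ (by decide) (by decide)).symm
  · intro i j h
    apply Mono.ext
    · exact p2 i j h
    · funext k
      fin_cases i <;> fin_cases j <;> first | (exfalso; simp at h; done) | skip
      all_goals
        clear h
        fin_cases k <;> simp [mg, mgp_apply, mgt, mgc]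
        all_goals first
          | exact ha.braid _ _ (by decide)
          | exact push_conj_inv ha 0
          | exact push_conj_inv ha 1
          | exact push_conj_inv ha 2
          | exact push_conj_inv ha 3
          | exact push_pair_inv ha 0
          | exact push_pair_inv ha 1
          | exact push_pair_inv ha 2
          | exact push_pair_inv ha 3

theorem push_prod {Q : Type} [Group Q] {a : Fin 4 → Q} (ha : IsBraid a)
    (h1 : wev a (gw ++ gw) = 1) :
    (wev a (pushw 0))⁻¹ * ((wev a (pushw 1))⁻¹ * ((wev a (pushw 2))⁻¹ *
      ((wev a (pushw 3))⁻¹ * (wev a (pushw 4))⁻¹))) = 1 := by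
  have h := push_all.2 Q a ha
  have h2 : wev a (gw ++ gw ++ gw ++ gw) = 1 := by
    rw [show gw ++ gw ++ gw ++ gw = (gw ++ gw) ++ (gw ++ gw) from rfl, wev_append, h1, mul_one]
  rw [h2] at h
  rw [← inv_eq_one] at h
  simpa [mul_assoc] using h

theorem mg_iota {Q : Type} [Group Q] {a : Fin 4 → Q} (ha : IsBraid a)
    (h1 : wev a (gw ++ gw) = 1) : wev (mg a) [0, 1, 2, 3, 4, 4, 3, 2, 1, 0] = 1 := by
  have p1 : wev (M := (Equiv.Perm (Fin 6))ᵐᵒᵖ) (fun i => MulOpposite.op (mgp i))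
      [0, 1, 2, 3, 4, 4, 3, 2, 1, 0] = 1 := by decide
  apply Mono.ext
  · exact congrArg MulOpposite.unop p1
  · funext k
    have h2 := push_prod ha h1
    fin_cases k
    · simpa [mg, mgp_apply, mgt, mgc] using h2
    all_goals
      clear h2
      simp [mg, mgp_apply, mgt, mgc, pushw]
      try group

theorem mg_delta {Q : Type} [Group Q] {a : Fin 4 → Q} (ha : IsBraid a)
    (h1 : wev a (gw ++ gw) = 1) :
    wev (mg a) [0, 1, 2, 3, 4, 0, 1, 2, 3, 4, 0, 1, 2, 3, 4, 0, 1, 2, 3, 4,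
      0, 1, 2, 3, 4, 0, 1, 2, 3, 4] = 1 := by
  have h2 := push_prod ha h1
  have h3 := gw_pow.2 Q a ha
  rw [h1] at h3
  let dp : Fin 6 → Fin 6 := ![5, 0, 1, 2, 3, 4]
  let dc : Fin 6 → Q := ![1, wev a [0, 1, 2, 3], wev a [0, 1, 2, 3], wev a [0, 1, 2, 3],
    wev a [0, 1, 2, 3], wev a [0, 1, 2, 3]]
  have hp : ∀ k, (wev (mg a) [0, 1, 2, 3, 4]).p k = dp k := by
    intro k
    fin_cases k <;> simp [mg, mgp_apply, mgt, dp]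
  have hc : ∀ k, (wev (mg a) [0, 1, 2, 3, 4]).c k = dc k := by
    intro k
    fin_cases k
    · simpa [mg, mgp_apply, mgt, mgc, dc] using h2
    all_goals simp [mg, mgp_apply, mgt, mgc, dc]
  have hd : wev (mg a) [0, 1, 2, 3, 4, 0, 1, 2, 3, 4, 0, 1, 2, 3, 4, 0, 1, 2, 3, 4,
      0, 1, 2, 3, 4, 0, 1, 2, 3, 4] = wev (mg a) [0, 1, 2, 3, 4] * (wev (mg a) [0, 1, 2, 3, 4] *
      (wev (mg a) [0, 1, 2, 3, 4] * (wev (mg a) [0, 1, 2, 3, 4] *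
      (wev (mg a) [0, 1, 2, 3, 4] * wev (mg a) [0, 1, 2, 3, 4])))) := by
    simp only [← wev_append]
    rfl
  rw [hd]
  generalize wev (mg a) [0, 1, 2, 3, 4] = D at hp hc
  apply Mono.ext
  · refine Equiv.ext fun k => ?_
    fin_cases k <;> simp [hp, dp]
  · funext k
    fin_cases k <;> simp [hp, hc, dp, dc, mul_assoc] <;> simpa [mul_assoc] using h3

/-- The linear action of monomial matrices. -/
def monoAct : Mono (Module.End ℂ KU)ˣ →* Module.End ℂ (Fin 6 → KU) where
  toFun x :=
    { toFun := fun f k => (x.c k : Module.End ℂ KU) (f (x.p k))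
      map_add' := fun f g => by funext k; simp only [Pi.add_apply, map_add]
      map_smul' := fun r f => by
        funext k
        simp only [Pi.smul_apply, LinearMap.map_smul, RingHom.id_apply] }
  map_one' := rfl
  map_mul' x y := rfl

theorem monoAct_apply (x : Mono (Module.End ℂ KU)ˣ) (f : Fin 6 → KU) (k : Fin 6) :
    monoAct x f k = (x.c k : Module.End ℂ KU) (f (x.p k)) := rfl

theorem monoAct_inj (x : Mono (Module.End ℂ KU)ˣ) (h : monoAct x = 1) : x = 1 := by
  have h1 : ∀ (f : Fin 6 → KU) (k : Fin 6), (x.c k : Module.End ℂ KU) (f (x.p k)) = f k := fun f k => by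
    rw [← monoAct_apply, h]; rfl
  have hp : ∀ k, x.p k = k := by
    intro k
    by_contra hk
    have := h1 (Pi.single k (fun _ => 1)) k
    rw [Pi.single_eq_of_ne hk, Pi.single_eq_same, map_zero] at this
    exact zero_ne_one (congrFun this 0)
  apply Mono.ext
  · exact Equiv.ext hp
  · funext k
    apply Units.ext
    refine LinearMap.ext fun u => ?_
    have := h1 (fun _ => u) k
    exact this

/-! ### The genus two mapping class group -/

/-- The word of the hyperelliptic involution. -/
def iw : List (Fin 5) := [0, 1, 2, 3, 4, 4, 3, 2, 1, 0]

/-- The word of the sixth power of the Coxeter element. -/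
def dw : List (Fin 5) := [0, 1, 2, 3, 4, 0, 1, 2, 3, 4, 0, 1, 2, 3, 4, 0, 1, 2, 3, 4,
      0, 1, 2, 3, 4, 0, 1, 2, 3, 4]

theorem lift_braidWord {K : Type} [Group K] (b : Fin 5 → K) :
    FreeGroup.lift b (braidWord 5 ^ 6) = wev b dw := by
  rw [map_pow]
  simp [braidWord, dw, pow_succ, mul_assoc]

theorem lift_sphereWord {K : Type} [Group K] (b : Fin 5 → K) :
    FreeGroup.lift b (puncturedSphereWord 5) = wev b iw := by
  simp [puncturedSphereWord, braidWord, iw, mul_assoc]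

/-- Homomorphisms out of the genus two mapping class group. -/
theorem g2_lift {K : Type} [Group K] (b : Fin 5 → K) (hb : IsBraid b) (hd : wev b dw = 1)
    (hi : wev b iw * wev b iw = 1) (hc : ∀ i, wev b iw * b i = b i * wev b iw) :
    ∃ f : Genus2MCG →* K, ∀ i, f (genus2Gen i) = b i := by
  have hr : ∀ r ∈ genus2RelsSet, FreeGroup.lift b r = 1 := by
    rintro r ((⟨i, j, ⟨h, rfl⟩ | ⟨h, rfl⟩⟩ | h) | ⟨i, rfl⟩)
    · simp only [map_mul, map_inv, FreeGroup.lift_apply_of]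
      rw [mul_inv_eq_one, mul_inv_eq_iff_eq_mul]
      rcases h with h | h
      · exact hb.comm _ _ h
      · exact (hb.comm _ _ h).symm
    · simp only [map_mul, map_inv, FreeGroup.lift_apply_of]
      rw [mul_inv_eq_one]
      rcases h with h | h
      · exact hb.braid _ _ h
      · exact (hb.braid _ _ h).symm
    · rcases h with rfl | rfl
      · rw [lift_braidWord, hd]
      · rw [map_pow, lift_sphereWord, pow_two, hi]
    · simp only [map_mul, map_inv, FreeGroup.lift_apply_of, lift_sphereWord]
      rw [mul_inv_eq_one, mul_inv_eq_iff_eq_mul, hc]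
  exact ⟨PresentedGroup.toGroup hr, fun i => PresentedGroup.toGroup.of hr⟩

/-- Generators. -/
abbrev ze : Fin 5 → Genus2MCG := genus2Gen

theorem mk_eq_lift (x : FreeGroup (Fin 5)) :
    PresentedGroup.mk genus2RelsSet x = FreeGroup.lift ze x := by
  have : PresentedGroup.mk genus2RelsSet = FreeGroup.lift ze := by
    ext i
    simp [genus2Gen, PresentedGroup.of]
  rw [this]

theorem rel_one {r : FreeGroup (Fin 5)} (h : r ∈ genus2RelsSet) : FreeGroup.lift ze r = 1 := by
  rw [← mk_eq_lift]
  exact PresentedGroup.one_of_mem h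

theorem ze_isBraid : IsBraid ze := by
  constructor
  · intro i j h
    have := rel_one (Or.inl (Or.inl ⟨i, j, Or.inl ⟨Or.inl h, rfl⟩⟩))
    simp only [map_mul, map_inv, FreeGroup.lift_apply_of] at this
    rwa [mul_inv_eq_one, mul_inv_eq_iff_eq_mul] at this
  · intro i j h
    have := rel_one (Or.inl (Or.inl ⟨i, j, Or.inr ⟨Or.inl h, rfl⟩⟩))
    simp only [map_mul, map_inv, FreeGroup.lift_apply_of] at this
    rwa [mul_inv_eq_one] at this

/-- The hyperelliptic involution. -/
def io : Genus2MCG := wev ze iw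

theorem ze_delta : wev ze dw = 1 := by
  rw [← lift_braidWord]
  exact rel_one (Or.inl (Or.inr (Or.inl rfl)))

theorem io_sq : io * io = 1 := by
  rw [io, ← lift_sphereWord, ← map_mul, ← pow_two]
  exact rel_one (Or.inl (Or.inr (Or.inr rfl)))

theorem io_comm (i : Fin 5) : io * ze i = ze i * io := by
  have := rel_one (Or.inr ⟨i, rfl⟩)
  simp only [map_mul, map_inv, FreeGroup.lift_apply_of, lift_sphereWord] at this
  rwa [mul_inv_eq_one, mul_inv_eq_iff_eq_mul] at this

theorem io_comm_wev (l : List (Fin 5)) : io * wev ze l = wev ze l * io := by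
  induction l with
  | nil => simp
  | cons s l ih => rw [wev_cons, ← mul_assoc, io_comm, mul_assoc, ih, mul_assoc]

theorem io_rot : wev ze [4, 3, 2, 1, 0, 0, 1, 2, 3, 4] = io := by
  have h := io_comm_wev [0, 1, 2, 3, 4]
  have e1 : io = wev ze [0, 1, 2, 3, 4] * wev ze [4, 3, 2, 1, 0] := by
    rw [← wev_append]; rfl
  have e2 : wev ze [4, 3, 2, 1, 0, 0, 1, 2, 3, 4] = wev ze [4, 3, 2, 1, 0] *
    wev ze [0, 1, 2, 3, 4] := by rw [← wev_append]; rfl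
  rw [e2]
  apply mul_left_cancel (a := wev ze [0, 1, 2, 3, 4])
  rw [← h, ← mul_assoc, ← e1]

theorem io_push : wev ze [3, 2, 1, 0, 0, 1, 2, 3, 4, 4] = io := by
  have h := io_comm 4
  apply mul_left_cancel (a := ze 4)
  rw [← h, ← io_rot]
  simp [mul_assoc]

/-- The first four generators. -/
def z4 (s : Fin 4) : Genus2MCG := ze s.castSucc

theorem z4_wev (l : List (Fin 4)) : wev z4 l = wev ze (l.map Fin.castSucc) := by
  simp only [wev, List.map_map]
  rfl

theorem z4_isBraid : IsBraid z4 :=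
  ⟨fun i j h => ze_isBraid.comm _ _ h, fun i j h => ze_isBraid.braid _ _ h⟩

theorem z4_twist : wev z4 (gw ++ gw) = io := by
  rw [← gw_pow.2 _ _ z4_isBraid, z4_wev]
  have h := twist_six.2 _ _ ze_isBraid
  have h2 : wev ze dw = 1 := ze_delta
  rw [dw, h] at h2
  have e : ∀ l l' : List (Fin 5), wev ze (l ++ l') = 1 → wev ze l' = io → wev ze l = io := by
    intro l l' h1 h2
    rw [wev_append, h2] at h1
    rw [eq_inv_of_mul_eq_one_left h1, inv_eq_of_mul_eq_one_left io_sq]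
  exact e _ [4, 3, 2, 1, 0, 0, 1, 2, 3, 4] h2 io_rot

theorem io_comm_z4 (l : List (Fin 4)) : io * wev z4 l = wev z4 l * io := by
  rw [z4_wev, io_comm_wev]

theorem io_pow_comm_z4 (e : ℕ) (l : List (Fin 4)) : io ^ e * wev z4 l = wev z4 l * io ^ e :=
  ((show Commute io (wev z4 l) from io_comm_z4 l).pow_left e).eq

theorem z4_inv (l : List (Fin 4)) : ∃ l' e, (wev z4 l)⁻¹ = wev z4 l' * io ^ e := by
  induction l with
  | nil => exact ⟨[], 0, by simp⟩
  | cons s l ih =>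
    obtain ⟨l', e, h⟩ := ih
    refine ⟨l' ++ cw s, e + 1, ?_⟩
    have hs : (z4 s)⁻¹ = wev z4 (cw s) * io := by
      have := (cw_left s).2 _ _ z4_isBraid
      rw [z4_twist, wev_cons] at this
      rw [inv_eq_iff_mul_eq_one, ← mul_assoc, this, io_sq]
    rw [wev_cons, mul_inv_rev, h, hs, wev_append, pow_succ, mul_assoc, ← mul_assoc (io ^ e),
      io_pow_comm_z4]
    simp [mul_assoc]

/-- The point stabilizer. -/
def stab : Subgroup Genus2MCG where
  carrier := {h | ∃ l e, h = wev z4 l * io ^ e}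
  one_mem' := ⟨[], 0, by simp⟩
  mul_mem' := by
    rintro _ _ ⟨l, e, rfl⟩ ⟨l', e', rfl⟩
    refine ⟨l ++ l', e + e', ?_⟩
    rw [wev_append, pow_add, mul_assoc, ← mul_assoc (io ^ e), io_pow_comm_z4]
    simp [mul_assoc]
  inv_mem' := by
    rintro _ ⟨l, e, rfl⟩
    obtain ⟨l', e', h⟩ := z4_inv l
    refine ⟨l', e + e', ?_⟩
    rw [mul_inv_rev, h, ← inv_pow, inv_eq_of_mul_eq_one_left io_sq, ← mul_assoc, io_pow_comm_z4,
      pow_add, mul_assoc]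

theorem z4_mem (l : List (Fin 4)) : wev z4 l ∈ stab := ⟨l, 0, by simp⟩

theorem io_mem : io ∈ stab := ⟨[], 1, by simp⟩

/-- Coset representatives. -/
def rr : Fin 6 → List (Fin 5) :=
  ![[4, 3, 2, 1, 0], [4, 3, 2, 1], [4, 3, 2], [4, 3], [4], []]

/-- Words of the cocycle off the diagonal. -/
def hw (i : Fin 5) (k : Fin 6) : List (Fin 4) :=
  if (k : ℕ) = i + 1 then [] else
    if (i : ℕ) < k then [Fin.ofNat 4 i] else [Fin.ofNat 4 (i - 1)]

theorem step_off (i : Fin 5) (k : Fin 6) (h : k ≠ i.castSucc) :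
    wev ze (rr k) * ze i = wev z4 (hw i k) * wev ze (rr (mgt i k)) := by
  have h1 : ∀ (i : Fin 5) (k : Fin 6), k ≠ i.castSucc →
      wchk (rr k ++ [i]) ((hw i k).map Fin.castSucc ++ rr (mgt i k)) = true := by
    decide +kernel
  have := (wchk_sound _ _ (h1 i k h)).2 _ _ ze_isBraid
  rw [wev_append, wev_append, ← z4_wev] at this
  simpa using this

/-- Conjugating words. -/
def uw : Fin 5 → List (Fin 5) := ![[3, 2, 1, 0], [3, 2, 1], [3, 2], [3], []]

theorem step_diag (i : Fin 5) :
    wev ze (rr i.castSucc) * ze i = (wev z4 (pushw i))⁻¹ * io * wev ze (rr (mgt i i.castSucc)) := by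
  have h1 : ∀ (i : Fin 5),
      wchk (uw i ++ ((pushw i).map Fin.castSucc ++ (rr i.castSucc ++ [i])))
        ([3, 2, 1, 0, 0, 1, 2, 3, 4, 4] ++ (uw i ++ rr (mgt i i.castSucc))) = true := by
    decide +kernel
  have := (wchk_sound _ _ (h1 i)).2 _ _ ze_isBraid
  rw [wev_append, wev_append, wev_append, ← z4_wev, wev_append, io_push, wev_append, ← mul_assoc io,
    io_comm_wev, mul_assoc (wev ze (uw i)), mul_right_inj] at this
  rw [mul_assoc, eq_inv_mul_iff_mul_eq, ← this]
  simp

theorem step (i : Fin 5) (k : Fin 6) :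
    ∃ h ∈ stab, wev ze (rr k) * ze i = h * wev ze (rr (mgt i k)) := by
  by_cases hk : k = i.castSucc
  · subst hk
    exact ⟨_, mul_mem (inv_mem (z4_mem _)) io_mem, step_diag i⟩
  · exact ⟨_, z4_mem _, step_off i k hk⟩

theorem coset (g : Genus2MCG) : ∃ h ∈ stab, ∃ k, g = h * wev ze (rr k) := by
  have hg : g ∈ Subgroup.closure (Set.range (PresentedGroup.of (rels := genus2RelsSet))) := by
    rw [PresentedGroup.closure_range_of]; trivial
  induction hg using Subgroup.closure_induction_right with
  | one => exact ⟨1, one_mem _, 5, by simp [rr]⟩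
  | mul_right x hx y hy ih =>
    obtain ⟨i, rfl⟩ := hy
    obtain ⟨h, hh, k, rfl⟩ := ih
    obtain ⟨h', hh', e⟩ := step i k
    refine ⟨h * h', mul_mem hh hh', mgt i k, ?_⟩
    rw [mul_assoc, mul_assoc, ← e]
    rfl
  | mul_inv_cancel x hx y hy ih =>
    obtain ⟨i, rfl⟩ := hy
    obtain ⟨h, hh, k, rfl⟩ := ih
    obtain ⟨h', hh', e⟩ := step i (mgt i k)
    have hinv : ∀ (i : Fin 5) (k : Fin 6), mgt i (mgt i k) = k := by decide
    rw [hinv] at e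
    refine ⟨h * h'⁻¹, mul_mem hh (inv_mem hh'), mgt i k, ?_⟩
    have e2 : wev ze (rr k) = h'⁻¹ * (wev ze (rr (mgt i k)) * ze i) := by
      rw [e, inv_mul_cancel_left]
    rw [e2]
    change h * (h'⁻¹ * (wev ze (rr (mgt i k)) * ze i)) * (ze i)⁻¹ = _
    group

/-- The kernel of the monomial representation consists of powers of the involution. -/
theorem kernel_mono {Q : Type} [Group Q] (a : Fin 4 → Q)
    (hk : ∀ l, wev a l = 1 → ∃ m, Weq l (tw m)) (F : Genus2MCG →* Mono Q)
    (hF : ∀ i, F (ze i) = mg a i) (hio : F io = 1) (g : Genus2MCG) (hg : F g = 1) :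
    ∃ n : ℕ, g = io ^ n := by
  obtain ⟨h, ⟨l, e, rfl⟩, k, rfl⟩ := coset g
  have hl : ∀ l : List (Fin 4), (F (wev z4 l)).p 5 = 5 ∧ (F (wev z4 l)).c 5 = wev a l := by
    intro l
    induction l with
    | nil => simp
    | cons s l ih =>
      have hs : (F (z4 s)).p 5 = 5 ∧ (F (z4 s)).c 5 = a s := by
        rw [z4, hF]
        fin_cases s <;> exact ⟨by simp [mg, mgp_apply, mgt], rfl⟩
      rw [wev_cons, map_mul]
      simp [hs.1, hs.2, ih.1, ih.2]
  have hr : (F (wev ze (rr k))).p 5 = k := by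
    rw [wev_map]
    simp only [hF]
    fin_cases k <;> simp [rr, mg, mgp_apply, mgt]
  rw [map_mul, map_mul, map_pow, hio, one_pow, mul_one] at hg
  have hk5 : k = 5 := by
    have := congrArg (fun x => x.p 5) hg
    simp only [mono_mul_p, Equiv.Perm.mul_apply, (hl l).1, hr, mono_one_p,
      Equiv.Perm.one_apply] at this
    exact this
  subst hk5
  have hr1 : wev ze (rr 5) = 1 := rfl
  rw [hr1, map_one, mul_one] at hg
  obtain ⟨m, hm⟩ := hk l (by rw [← (hl l).2, hg]; rfl)
  have htw : ∀ m, wev z4 (tw m) = io ^ m := by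
    intro m
    induction m with
    | zero => simp [tw]
    | succ m ih =>
      have h6 : tw (m + 1) = (gw ++ gw) ++ tw m := by
        simp [tw, List.replicate_succ]
      rw [h6, wev_append, ih, z4_twist, pow_succ']
  refine ⟨m + e, ?_⟩
  rw [hr1, mul_one, hm.2 _ _ z4_isBraid, htw, pow_add]


/-! ### The symplectic representation -/

/-- The symplectic transvections. -/
def sy : Fin 5 → (Matrix (Fin 4) (Fin 4) ℤ)ˣ
  | 0 => ⟨!![1, 1, 0, 0; 0, 1, 0, 0; 0, 0, 1, 0; 0, 0, 0, 1],
      !![1, -1, 0, 0; 0, 1, 0, 0; 0, 0, 1, 0; 0, 0, 0, 1], by decide +kernel, by decide +kernel⟩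
  | 1 => ⟨!![1, 0, 0, 0; -1, 1, 1, 0; 0, 0, 1, 0; 0, 0, 0, 1],
      !![1, 0, 0, 0; 1, 1, -1, 0; 0, 0, 1, 0; 0, 0, 0, 1], by decide +kernel, by decide +kernel⟩
  | 2 => ⟨!![1, 0, 0, 0; 0, 1, 0, 0; 0, -1, 1, 1; 0, 0, 0, 1],
      !![1, 0, 0, 0; 0, 1, 0, 0; 0, 1, 1, -1; 0, 0, 0, 1], by decide +kernel, by decide +kernel⟩
  | 3 => ⟨!![1, 0, 0, 0; 0, 1, 0, 0; 0, 0, 1, 0; 0, 0, -1, 1],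
      !![1, 0, 0, 0; 0, 1, 0, 0; 0, 0, 1, 0; 0, 0, 1, 1], by decide +kernel, by decide +kernel⟩
  | 4 => ⟨!![1, 0, 0, 1; 0, 1, 0, 0; 0, 0, 1, 1; 0, 0, 0, 1],
      !![1, 0, 0, -1; 0, 1, 0, 0; 0, 0, 1, -1; 0, 0, 0, 1], by decide +kernel, by decide +kernel⟩

theorem sy_isBraid : IsBraid sy := by
  have h1 : ∀ i j : Fin 5, (i : ℕ) + 2 ≤ (j : ℕ) →
      (sy i : Matrix (Fin 4) (Fin 4) ℤ) * sy j = sy j * sy i := by decide +kernel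
  have h2 : ∀ i j : Fin 5, (i : ℕ) + 1 = (j : ℕ) →
      (sy i : Matrix (Fin 4) (Fin 4) ℤ) * sy j * sy i = sy j * sy i * sy j := by decide +kernel
  exact ⟨fun i j h => Units.ext (h1 i j h), fun i j h => Units.ext (h2 i j h)⟩

theorem sy_x : ((wev sy [0, 1, 2, 3, 4] : (Matrix (Fin 4) (Fin 4) ℤ)ˣ) :
    Matrix (Fin 4) (Fin 4) ℤ) = !![0, 0, 0, 1; -1, 0, 0, 0; 0, -1, 0, 1; 0, 0, -1, 0] := by
  decide +kernel

theorem sy_y : ((wev sy [4, 3, 2, 1, 0] : (Matrix (Fin 4) (Fin 4) ℤ)ˣ) :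
    Matrix (Fin 4) (Fin 4) ℤ) = !![0, 1, 0, 0; -1, 0, 1, 0; 0, 0, 0, 1; -1, 0, 0, 0] := by
  decide +kernel

theorem sy_iota : wev sy iw = -1 := by
  have e : wev sy iw = wev sy [0, 1, 2, 3, 4] * wev sy [4, 3, 2, 1, 0] := by
    rw [← wev_append]; rfl
  rw [e]
  apply Units.ext
  rw [Units.val_mul, sy_x, sy_y]
  decide +kernel

theorem sy_delta : wev sy dw = 1 := by
  have e : wev sy dw = (wev sy [0, 1, 2, 3, 4] * wev sy [0, 1, 2, 3, 4] *
      wev sy [0, 1, 2, 3, 4]) * (wev sy [0, 1, 2, 3, 4] * wev sy [0, 1, 2, 3, 4] *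
      wev sy [0, 1, 2, 3, 4]) := by
    simp only [← wev_append]; rfl
  have e3 : ((wev sy [0, 1, 2, 3, 4] * wev sy [0, 1, 2, 3, 4] *
      wev sy [0, 1, 2, 3, 4] : (Matrix (Fin 4) (Fin 4) ℤ)ˣ) : Matrix (Fin 4) (Fin 4) ℤ)
      = !![0, 1, 0, -1; 0, 0, 1, 0; 0, 1, 0, 0; -1, 0, 1, 0] := by
    rw [Units.val_mul, Units.val_mul, sy_x]
    decide +kernel
  rw [e]
  apply Units.ext
  rw [Units.val_mul, e3]
  decide +kernel

/-- The symplectic representation as endomorphisms of `ℂ⁴`. -/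
noncomputable def syAct : (Matrix (Fin 4) (Fin 4) ℤ)ˣ →* Module.End ℂ (Fin 4 → ℂ) :=
  ((Matrix.toLinAlgEquiv' : Matrix (Fin 4) (Fin 4) ℂ ≃ₐ[ℂ] _).toRingEquiv.toRingHom.comp
    (Int.castRingHom ℂ).mapMatrix).toMonoidHom.comp (Units.coeHom _)

theorem syAct_neg_one : syAct (-1) = -1 := by
  change ((Matrix.toLinAlgEquiv' : Matrix (Fin 4) (Fin 4) ℂ ≃ₐ[ℂ] _).toRingEquiv.toRingHom.comp
    (Int.castRingHom ℂ).mapMatrix) ((-1 : (Matrix (Fin 4) (Fin 4) ℤ)ˣ) : Matrix (Fin 4) (Fin 4) ℤ)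
    = -1
  rw [Units.val_neg, Units.val_one, map_neg, map_one]

/-! ### The main theorem -/

/-- The mapping class group of the closed orientable genus-two surface embeds
into `GL(64, ℂ)`; in particular it is linear. -/
theorem genus2MCG_linear :
    ∃ ρ : Genus2MCG →* Matrix.GeneralLinearGroup (Fin 64) ℂ,
      Function.Injective ρ := by
  obtain ⟨a, ha, h1, hk⟩ := exists_rep
  have hmi : wev (mg a) iw = 1 := mg_iota ha h1
  obtain ⟨F, hF⟩ := g2_lift (mg a) (mg_isBraid ha) (mg_delta ha h1)
    (by rw [hmi, mul_one]) (fun i => by rw [hmi, one_mul, mul_one])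
  obtain ⟨S, hS⟩ := g2_lift sy sy_isBraid sy_delta
    (by rw [sy_iota]; simp) (fun i => by rw [sy_iota]; simp)
  have hFio : F io = 1 := by
    rw [io, wev_map]
    simp only [hF]
    exact hmi
  have hSio : S io = -1 := by
    rw [io, wev_map]
    simp only [hS]
    exact sy_iota
  let b : Module.Basis (Fin 64) ℂ ((Fin 6 → KU) × (Fin 4 → ℂ)) :=
    Module.finBasisOfFinrankEq ℂ _ (by simp [Module.finrank_pi_fintype])
  let T : Genus2MCG →* Module.End ℂ ((Fin 6 → KU) × (Fin 4 → ℂ)) :=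
    (LinearMap.prodMapRingHom ℂ (Fin 6 → KU) (Fin 4 → ℂ)).toMonoidHom.comp
      ((monoAct.comp F).prod (syAct.comp S))
  let ρ : Genus2MCG →* Matrix (Fin 64) (Fin 64) ℂ :=
    (LinearMap.toMatrixAlgEquiv b).toRingEquiv.toRingHom.toMonoidHom.comp T
  refine ⟨ρ.toHomUnits, ?_⟩
  rw [injective_iff_map_eq_one]
  intro g hg
  have hρ : ρ g = 1 := by
    have := congrArg (fun u : Matrix.GeneralLinearGroup (Fin 64) ℂ =>
      (u : Matrix (Fin 64) (Fin 64) ℂ)) hg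
    exact this
  have hT : T g = 1 := by
    apply (LinearMap.toMatrixAlgEquiv b).injective
    rw [map_one]
    exact hρ
  have hTv : ∀ v w, (monoAct (F g) v, syAct (S g) w) = (v, w) := fun v w =>
    congrArg (fun f : Module.End ℂ ((Fin 6 → KU) × (Fin 4 → ℂ)) => f (v, w)) hT
  have hFg : F g = 1 := monoAct_inj _ (LinearMap.ext fun v => (Prod.ext_iff.1 (hTv v 0)).1)
  have hSg : syAct (S g) = 1 := LinearMap.ext fun w => (Prod.ext_iff.1 (hTv 0 w)).2
  obtain ⟨n, rfl⟩ := kernel_mono a hk F hF hFio g hFg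
  rcases Nat.even_or_odd n with hn | hn
  · obtain ⟨m, rfl⟩ := hn
    rw [← two_mul, pow_mul, pow_two, io_sq, one_pow]
  · exfalso
    rw [map_pow, hSio, hn.neg_one_pow, syAct_neg_one] at hSg
    have := congrFun (congrArg (fun f : Module.End ℂ (Fin 4 → ℂ) => f (fun _ => 1)) hSg) 0
    simp at this
    norm_num at this
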